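/- Let M be a countably infinite homogeneous structure in a finite binary relational language with a distinguished linear order ≤ among its relations, such that M is order-like and its automorphism group acts transitively on M. Let E be the coarsest proper ∅-definable ≤-convex equivalence relation on M (E is ∅-definable, ≤-convex, not the trivial relation, and every ∅-definable ≤-convex equivalence relation other than the trivial relation refines E). Then for every a ∈ M and every cut S of (M, ≤) that is invariant under all automorphisms fixing a: (i) every x ∈ M satisfying x < y for all y in the E-class of a belongs to S, and (ii) every x ∈ S satisfies x ≤ y for some y in the E-class of a. (That is, inf(a/E) ≤ S ≤ sup(a/E).) -/

import Mathlib

/-- A structure on `M` with `m` binary relations, among which a distinguished linear order,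
given by the index `ord`. -/
structure BinStruct (m : ℕ) (M : Type*) where
  rel : Fin m → M → M → Prop
  ord : Fin m
  total : ∀ x y, rel ord x y ∨ rel ord y x
  antisymm : ∀ x y, rel ord x y → rel ord y x → x = y
  trans : ∀ x y z, rel ord x y → rel ord y z → rel ord x z

namespace BinStruct

variable {m : ℕ} {M : Type*} (S : BinStruct m M)

/-- The distinguished linear order. -/
def le (x y : M) : Prop := S.rel S.ord x y

/-- An automorphism: a bijection of `M` preserving all the relations. -/
def IsAuto (σ : M ≃ M) : Prop :=
  ∀ i x y, S.rel i x y ↔ S.rel i (σ x) (σ y)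

/-- Homogeneity: every isomorphism between finite substructures extends to an automorphism. -/
def Homogeneous : Prop :=
  ∀ (A : Finset M) (f : M → M), Set.InjOn f A →
    (∀ i, ∀ x ∈ A, ∀ y ∈ A, (S.rel i x y ↔ S.rel i (f x) (f y))) →
    ∃ σ : M ≃ M, S.IsAuto σ ∧ ∀ a ∈ A, σ a = f a

/-- A binary relation is ∅-definable iff it is invariant under all automorphisms. -/
def Definable (R : M → M → Prop) : Prop :=
  ∀ σ : M ≃ M, S.IsAuto σ → ∀ x y, R x y ↔ R (σ x) (σ y)

/-- `E` is `≤`-convex: every `E`-class is an interval with respect to `≤`. -/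
def Convex (E : M → M → Prop) : Prop :=
  ∀ x y z, S.le x y → S.le y z → E x z → E x y

/-- The automorphism group acts transitively on `M`. -/
def TransAction : Prop := ∀ x y : M, ∃ σ : M ≃ M, S.IsAuto σ ∧ σ x = y

/-- The pairs `(a,b)` and `(c,d)` lie in the same orbit of the automorphism group. -/
def SamePairOrbit (a b c d : M) : Prop := ∃ σ : M ≃ M, S.IsAuto σ ∧ σ a = c ∧ σ b = d

/-- `M` is order-like: whenever `(a,b)` and `(b,c)` lie in the same orbit of the automorphism
group acting on `M × M`, the pair `(a,c)` also lies in that orbit. -/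
def OrderLike : Prop := ∀ a b c : M, S.SamePairOrbit a b b c → S.SamePairOrbit a b a c

/-- A cut of `(M, ≤)`: a nonempty, proper, downward closed subset with no greatest element. -/
def IsCut (C : Set M) : Prop :=
  C.Nonempty ∧ C ≠ Set.univ ∧ (∀ x y, S.le x y → y ∈ C → x ∈ C) ∧
    (∀ x ∈ C, ∃ y ∈ C, S.le x y ∧ x ≠ y)

end BinStruct

/-- A transitive group `G` of order automorphisms of `M`, whose finitely many orbits on pairs are
the fibres of `T` and satisfy the order-like condition, and whose orbits on triples are determined
by the orbits of the three pairs. -/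
structure OrderLikeAction (M τ : Type*) [LinearOrder M] where
  G : Subgroup (Equiv.Perm M)
  T : M → M → τ
  le_map : ∀ g ∈ G, ∀ x y, x ≤ y → g x ≤ g y
  T_map : ∀ g ∈ G, ∀ x y, T (g x) (g y) = T x y
  exists_map_eq : ∀ x y, ∃ g ∈ G, g x = y
  exists_map_pair : ∀ a b c d, T a b = T c d → ∃ g ∈ G, g a = c ∧ g b = d
  exists_map_triple : ∀ a b c a' b' c', T a b = T a' b' → T b c = T b' c' → T a c = T a' c' →
    ∃ g ∈ G, g a = a' ∧ g b = b' ∧ g c = c'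
  orderLike : ∀ a b c, T a b = T b c → T a c = T a b

namespace OrderLikeAction

variable {M τ : Type*} [LinearOrder M]

/-- The same action on the reversed order. -/
def dual (A : OrderLikeAction M τ) : OrderLikeAction Mᵒᵈ τ where
  G := A.G
  T x y := A.T y x
  le_map g hg x y h := A.le_map g hg y x h
  T_map g hg x y := A.T_map g hg y x
  exists_map_eq := A.exists_map_eq
  exists_map_pair a b c d h := by
    obtain ⟨g, hg, h1, h2⟩ := A.exists_map_pair b a d c h
    exact ⟨g, hg, h2, h1⟩
  exists_map_triple a b c a' b' c' h1 h2 h3 := by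
    obtain ⟨g, hg, e1, e2, e3⟩ := A.exists_map_triple c b a c' b' a' h2 h1 h3
    exact ⟨g, hg, e3, e2, e1⟩
  orderLike a b c h := (A.orderLike c b a h.symm).trans h.symm

variable (A : OrderLikeAction M τ)

/-- Invariance of a binary relation under the group. -/
def Inv (R : M → M → Prop) : Prop := ∀ g ∈ A.G, ∀ x y, R x y → R (g x) (g y)

/-- `E` is the coarsest nontrivial invariant convex equivalence relation. -/
structure IsCoarsest (E : M → M → Prop) : Prop where
  equiv : Equivalence E
  inv : A.Inv E
  convex : ∀ x y z, x ≤ y → y ≤ z → E x z → E x y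
  coarsest : ∀ F : M → M → Prop, A.Inv F → Equivalence F →
    (∀ x y z, x ≤ y → y ≤ z → F x z → F x y) → (¬ ∀ x y, F x y) → ∀ x y, F x y → E x y

/-- Each `P x` is a proper initial segment reaching beyond the `E`-class of `x`. -/
structure IsFarBound (E P : M → M → Prop) : Prop where
  inv : A.Inv P
  down : ∀ x y z, y ≤ z → P x z → P x y
  proper : ∀ x, ∃ y, ¬ P x y
  far : ∀ x, ∃ y, x < y ∧ ¬ E x y ∧ P x y

/-- The union of all far bounds. -/
def farUnion (E : M → M → Prop) (x y : M) : Prop := ∃ P, A.IsFarBound E P ∧ P x y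

variable {A}

theorem lt_map {g : Equiv.Perm M} (hg : g ∈ A.G) {x y : M} (h : x < y) : g x < g y :=
  lt_of_le_of_ne (A.le_map g hg x y h.le) fun e => h.ne (g.injective e)

theorem Inv.iff {R : M → M → Prop} (hR : A.Inv R) {g : Equiv.Perm M} (hg : g ∈ A.G) (x y : M) :
    R (g x) (g y) ↔ R x y :=
  ⟨fun h => by simpa using hR g⁻¹ (A.G.inv_mem hg) _ _ h, hR g hg x y⟩

theorem Inv.of_T_eq {R : M → M → Prop} (hR : A.Inv R) {a b c d : M} (h : A.T a b = A.T c d)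
    (hab : R a b) : R c d := by
  obtain ⟨g, hg, rfl, rfl⟩ := A.exists_map_pair a b c d h
  exact hR g hg _ _ hab

theorem inv_exists_ge (r : τ) : A.Inv fun x w => ∃ y, w ≤ y ∧ A.T x y = r := by
  rintro g hg x w ⟨y, hwy, hy⟩
  exact ⟨g y, A.le_map g hg _ _ hwy, (A.T_map g hg _ _).trans hy⟩

theorem IsCoarsest.dual {E : M → M → Prop} (hE : A.IsCoarsest E) :
    A.dual.IsCoarsest (M := Mᵒᵈ) E where
  equiv := hE.equiv
  inv := hE.inv
  convex x y z hxy hyz h :=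
    hE.equiv.trans h (hE.convex z y x hyz hxy (hE.equiv.symm h))
  coarsest F hF hF' hc :=
    hE.coarsest F hF hF' fun x y z hxy hyz h =>
      hF'.trans h (hc z y x hyz hxy (hF'.symm h))

variable {E : M → M → Prop}

theorem IsFarBound.refl {P : M → M → Prop} (hP : A.IsFarBound E P) (x : M) : P x x := by
  obtain ⟨y, hxy, -, h⟩ := hP.far x
  exact hP.down _ _ _ hxy.le h

theorem IsFarBound.of_class (hE : A.IsCoarsest E) {P : M → M → Prop} (hP : A.IsFarBound E P)
    {x y : M} (h : E x y) : P x y := by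
  obtain ⟨z, hxz, hn, hz⟩ := hP.far x
  exact hP.down _ _ _ (le_of_not_ge fun hzy => hn (hE.convex _ _ _ hxz.le hzy h)) hz

theorem IsCoarsest.unbounded_of_not_farUnion (hE : A.IsCoarsest E) {x y : M} (hxy : x < y)
    (hn : ¬ E x y) (h : ¬ A.farUnion E x y) (w : M) : ∃ z, w ≤ z ∧ A.T x z = A.T x y := by
  by_contra hw
  have hinv := inv_exists_ge (A := A) (A.T x y)
  refine h ⟨_, ⟨hinv, ?_, ?_, ?_⟩, ⟨y, le_rfl, rfl⟩⟩
  · rintro u v w hvw ⟨z, hz, hT⟩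
    exact ⟨z, hvw.trans hz, hT⟩
  · intro u
    obtain ⟨g, hg, rfl⟩ := A.exists_map_eq x u
    exact ⟨g w, fun h' => hw ((hinv.iff hg x w).1 h')⟩
  · intro u
    obtain ⟨g, hg, rfl⟩ := A.exists_map_eq x u
    exact ⟨g y, lt_map hg hxy, fun h' => hn ((hE.inv.iff hg x y).1 h'),
      g y, le_rfl, A.T_map g hg _ _⟩

theorem IsCoarsest.exists_between (hE : A.IsCoarsest E) {a z : M} (haz : a < z)
    (hn : ¬ E a z) : ∃ b, a < b ∧ b < z ∧ ¬ E a b ∧ ¬ E b z := by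
  obtain ⟨g, hg, hgz⟩ := A.exists_map_eq a z
  have hT : A.T a z = A.T z (g z) := by
    rw [← A.T_map g hg a z, hgz]
  obtain ⟨k, hk, hka, hkz⟩ := A.exists_map_pair _ _ _ _ (A.orderLike _ _ _ hT)
  have hlt : z < g z := by simpa [hgz] using lt_map hg haz
  have hn' : ¬ E z (g z) := fun h => hn ((hE.inv.iff hg a z).1 (by rwa [hgz]))
  refine ⟨k z, ?_, ?_, ?_, ?_⟩
  · simpa [hka] using lt_map hk haz
  · simpa [hkz] using lt_map hk hlt
  · exact fun h => hn ((hE.inv.iff hk a z).1 (by rwa [hka]))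
  · exact fun h => hn' ((hE.inv.iff hk z (g z)).1 (by rwa [hkz]))

section Finite

variable [Finite τ]

/-- If the points of each type over `a` that satisfy `p` are bounded by a point satisfying `Q`,
then so are all the points satisfying `p`. -/
theorem exists_uniform_bound {a : M} {p Q : M → Prop}
    (h : ∀ q, ∃ w, Q w ∧ ∀ y, A.T a y = q → p y → y < w) :
    ∃ w, Q w ∧ ∀ y, p y → y < w := by
  choose w hQ hw using h
  have : Nonempty τ := ⟨A.T a a⟩
  obtain ⟨q, hq⟩ := Finite.exists_max w
  exact ⟨w q, hQ q, fun y hy => (hw _ y rfl hy).trans_le (hq _)⟩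

theorem exists_absorbing {D : M → M → Prop} (hD : A.Inv D)
    (hdown : ∀ x y z, y ≤ z → D x z → D x y) {a z : M} (haz : D a z) :
    ∃ b, z ≤ b ∧ D a b ∧ ∀ w, D b w → D a w := by
  obtain ⟨q, hq⟩ : ∃ q, ∀ w, D a w → ∃ y, w ≤ y ∧ A.T a y = q ∧ D a y := by
    by_contra! hcon
    obtain ⟨w, hw, hb⟩ : ∃ w, D a w ∧ ∀ y, D a y → y < w := by
      refine exists_uniform_bound (A := A) (a := a) fun q => ?_
      obtain ⟨w, hw, hwq⟩ := hcon q
      exact ⟨w, hw, fun y hy hay => lt_of_not_ge fun hle => hwq y hle hy hay⟩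
    exact lt_irrefl _ (hb w hw)
  obtain ⟨b, hzb, hbq, hab⟩ := hq z haz
  refine ⟨b, hzb, hab, fun w hbw => ?_⟩
  obtain ⟨g, hg, rfl⟩ := A.exists_map_eq a b
  obtain ⟨y, hy, hyq, -⟩ := hq (g.symm w) ((hD.iff hg _ _).1 (by simpa using hbw))
  have h1 : A.T (g a) (g y) = q := (A.T_map g hg _ _).trans hyq
  have h2 : A.T a (g y) = A.T a (g a) := A.orderLike _ _ _ (hbq.trans h1.symm)
  refine hdown _ _ (g y) ?_ (hD.of_T_eq h2.symm hab)
  simpa using A.le_map g hg _ _ hy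

/-- A monotone invariant family of initial segments reaching beyond an `E`-class is trivial. -/
theorem IsCoarsest.forall_of_monotone (hE : A.IsCoarsest E) {D : M → M → Prop} (hD : A.Inv D)
    (hdown : ∀ x y z, y ≤ z → D x z → D x y) (hmono : ∀ x y, x ≤ y → ∀ w, D x w → D y w)
    {a z : M} (haz : a < z) (hn : ¬ E a z) (h : D a z) : ∀ x y, D x y := by
  have hF : ∀ x y, ∀ w, D x w ↔ D y w := by
    by_contra hcon
    refine hn (hE.coarsest (fun x y => ∀ w, D x w ↔ D y w) ?_ ?_ ?_ hcon a z ?_)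
    · intro g hg x y hxy w
      have := hxy (g.symm w)
      simpa using (hD.iff hg x _).trans (this.trans (hD.iff hg y _).symm)
    · exact ⟨fun _ _ => Iff.rfl, fun h w => (h w).symm, fun h h' w => (h w).trans (h' w)⟩
    · exact fun x y z hxy hyz hxz w =>
        ⟨hmono x y hxy w, fun hw => (hxz w).2 (hmono y z hyz w hw)⟩
    · obtain ⟨b, hzb, -, hb⟩ := exists_absorbing hD hdown h
      exact fun w => ⟨hmono a z haz.le w, fun hw => hb w (hmono z b hzb w hw)⟩
  intro x y
  obtain ⟨g, hg, rfl⟩ := A.exists_map_eq a y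
  exact (hF _ x _).1 (hD g hg a a (hdown _ _ _ haz.le h))

theorem IsFarBound.exists_le (hE : A.IsCoarsest E) {P : M → M → Prop} (hP : A.IsFarBound E P)
    (a y : M) : ∃ x ≤ a, P x y := by
  obtain ⟨z, haz, hn, hz⟩ := hP.far a
  refine hE.forall_of_monotone (D := fun a y => ∃ x ≤ a, P x y) ?_ ?_ ?_ haz hn
    ⟨a, le_rfl, hz⟩ a y
  · rintro g hg a y ⟨x, hxa, hxy⟩
    exact ⟨g x, A.le_map g hg _ _ hxa, hP.inv g hg _ _ hxy⟩
  · rintro x y z hyz ⟨u, hu, huz⟩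
    exact ⟨u, hu, hP.down _ _ _ hyz huz⟩
  · rintro x y hxy w ⟨u, hu, huw⟩
    exact ⟨u, hu.trans hxy, huw⟩

theorem IsFarBound.exists_ge (hE : A.IsCoarsest E) {P : M → M → Prop} (hP : A.IsFarBound E P)
    {a z : M} (haz : a < z) (hn : ¬ E a z) : ∃ x ≥ a, ¬ P x z := by
  by_contra! hcon
  obtain ⟨y, hy⟩ := hP.proper a
  refine hy (hE.forall_of_monotone (D := fun a y => ∀ x ≥ a, P x y) ?_ ?_ ?_ haz hn hcon
    a y a le_rfl)
  · intro g hg a y h x hx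
    have := h (g.symm x) (by simpa using A.le_map g⁻¹ (A.G.inv_mem hg) _ _ hx)
    simpa using hP.inv g hg _ _ this
  · exact fun x y z hyz h u hu => hP.down _ _ _ hyz (h u hu)
  · exact fun x y hxy w h u hu => h u (hxy.trans hu)

theorem isFarBound_farUnion {P : M → M → Prop} (hP : A.IsFarBound E P) :
    A.IsFarBound E (A.farUnion E) where
  inv := fun g hg x y ⟨Q, hQ, h⟩ => ⟨Q, hQ, hQ.inv g hg _ _ h⟩
  down := fun x y z hyz ⟨Q, hQ, h⟩ => ⟨Q, hQ, hQ.down _ _ _ hyz h⟩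
  proper x := by
    by_contra! hcon
    obtain ⟨w, -, hw⟩ : ∃ w, True ∧ ∀ y, True → y < w := by
      refine exists_uniform_bound (A := A) (a := x) fun q => ?_
      by_cases hq : ∃ y, A.T x y = q
      · obtain ⟨y, rfl⟩ := hq
        obtain ⟨Q, hQ, hxy⟩ := hcon y
        obtain ⟨w, hw⟩ := hQ.proper x
        exact ⟨w, trivial, fun z hz _ => lt_of_not_ge fun hwz =>
          hw (hQ.down _ _ _ hwz (hQ.inv.of_T_eq hz.symm hxy))⟩
      · exact ⟨x, trivial, fun y hy => (hq ⟨y, hy⟩).elim⟩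
    exact lt_irrefl _ (hw w trivial)
  far x := by
    obtain ⟨y, hxy, hn, h⟩ := hP.far x
    exact ⟨y, hxy, hn, P, hP, h⟩

theorem IsCoarsest.exists_not_farUnion (hE : A.IsCoarsest E) {a z : M} (haz : a < z)
    (hn : ¬ E a z) : ∃ x, a ≤ x ∧ x < z ∧ ¬ E x z ∧ ¬ A.farUnion E x z := by
  by_cases hP : ∃ P, A.IsFarBound E P
  · obtain ⟨P, hP⟩ := hP
    have hU := isFarBound_farUnion hP
    obtain ⟨x, hax, hx⟩ := hU.exists_ge hE haz hn
    exact ⟨x, hax, lt_of_not_ge fun h => hx (hU.down _ _ _ h (hU.refl x)),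
      fun h => hx (hU.of_class hE h), hx⟩
  · exact ⟨a, le_rfl, haz, hn, fun ⟨P, h, _⟩ => hP ⟨P, h⟩⟩

/-- Every interval that is not contained in an `E`-class contains a pair whose type is unbounded
on both sides. -/
theorem IsCoarsest.exists_unbounded_pair (hE : A.IsCoarsest E) {a z : M} (haz : a < z)
    (hn : ¬ E a z) : ∃ u v, a ≤ u ∧ u < v ∧ v ≤ z ∧
      (∀ w, ∃ y, w ≤ y ∧ A.T u y = A.T u v) ∧ ∀ w, ∃ y, y ≤ w ∧ A.T y v = A.T u v := by
  obtain ⟨b, hab, hbz, hnab, hnbz⟩ := hE.exists_between haz hn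
  obtain ⟨u, hau, hub, hnub, hu⟩ := hE.exists_not_farUnion hab hnab
  obtain ⟨v, hvz, hbv, hnvb, hv⟩ : ∃ v : M, v ≤ z ∧ b < v ∧ ¬ E v b ∧
      ¬ A.dual.farUnion (M := Mᵒᵈ) E v b :=
    hE.dual.exists_not_farUnion (M := Mᵒᵈ) (a := z) (z := b)
      hbz fun h => hnbz (hE.equiv.symm h)
  have huv : u < v := hub.trans hbv
  have hnuv : ¬ E u v := fun h => hnub (hE.convex u b v hub.le hbv.le h)
  refine ⟨u, v, hau, huv, hvz, ?_, ?_⟩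
  · refine hE.unbounded_of_not_farUnion huv hnuv ?_
    rintro ⟨P, hP, h⟩
    exact hu ⟨P, hP, hP.down _ _ _ hbv.le h⟩
  · refine hE.dual.unbounded_of_not_farUnion (M := Mᵒᵈ) (x := v) (y := u) huv
      (fun h => hnuv (hE.equiv.symm h)) ?_
    rintro ⟨P, hP, h⟩
    exact hv ⟨P, hP, hP.down v b u hub.le h⟩

/-- Near the end of `P x`, the segments `P y` are contained in `P x`. -/
theorem IsFarBound.exists_nested {P : M → M → Prop} (hP : A.IsFarBound E P) (x : M) :
    ∃ u, x ≤ u ∧ P x u ∧ ∀ y, u ≤ y → P x y → ∀ w, P y w → P x w := by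
  obtain ⟨u, ⟨hxu, hu⟩, h⟩ : ∃ u, (x ≤ u ∧ P x u) ∧
      ∀ y, (P x y ∧ ∃ w, P y w ∧ ¬ P x w) → y < u := by
    refine exists_uniform_bound (A := A) (a := x) fun q => ?_
    by_cases hq : ∃ y, A.T x y = q ∧ P x y ∧ ∃ w, P y w ∧ ¬ P x w
    · obtain ⟨y, rfl, hxy, w, hyw, hxw⟩ := hq
      obtain ⟨g, hg, hgy⟩ := A.exists_map_eq y x
      have hgw : P x (g w) := hgy ▸ hP.inv g hg _ _ hyw
      have hT : A.T (g x) x = A.T x y := by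
        have := A.T_map g hg x y
        rwa [hgy] at this
      refine ⟨max x (g w), ⟨le_max_left _ _, ?_⟩, fun z hz _ => lt_max_of_lt_right ?_⟩
      · rcases max_choice x (g w) with h | h <;> rw [h]
        exacts [hP.refl _, hgw]
      · have hz' : A.T (g x) z = A.T x y :=
          (A.orderLike _ _ _ (hT.trans hz.symm)).trans hT
        exact lt_of_not_ge fun hwz => hxw ((hP.inv.iff hg x w).1
          (hP.down _ _ _ hwz (hP.inv.of_T_eq hz'.symm hxy)))
    · exact ⟨x, ⟨le_rfl, hP.refl x⟩, fun y hy hy' => (hq ⟨y, hy, hy'⟩).elim⟩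
  refine ⟨u, hxu, hu, fun y huy hxy w hyw => ?_⟩
  by_contra hxw
  exact (h y ⟨hxy, w, hyw, hxw⟩).not_ge huy

theorem IsCoarsest.not_isFarBound (hE : A.IsCoarsest E) [Nonempty M] {P : M → M → Prop} :
    ¬ A.IsFarBound E P := by
  intro hP
  inhabit M
  let x : M := default
  obtain ⟨u, hxu, hu, hnest⟩ := hP.exists_nested x
  obtain ⟨z, huz, hn, hz⟩ := hP.far u
  have hxz : P x z := hnest u le_rfl hu z hz
  obtain ⟨s, v, hus, hsv, hvz, hup, hlow⟩ := hE.exists_unbounded_pair huz hn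
  obtain ⟨w, hw⟩ := hP.proper x
  obtain ⟨g, hg, hgs⟩ := A.exists_map_eq s v
  obtain ⟨c, hwc, hTc⟩ : ∃ c, w ≤ c ∧ A.T v c = A.T s v := by
    simpa [hgs] using inv_exists_ge (A := A) (A.T s v) g hg s (g.symm w) (hup _)
  obtain ⟨y, hyv, hyc⟩ := hP.exists_le hE v c
  obtain ⟨b, hby, hTb⟩ := hlow y
  obtain ⟨k, hk, hkb, hkv, hkc⟩ := A.exists_map_triple b v c s v c hTb rfl <| by
    rw [A.orderLike b v c (hTb.trans hTc.symm), A.orderLike s v c hTc.symm, hTb]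
  have hsy : s ≤ k y := hkb ▸ A.le_map k hk _ _ hby
  have hyv' : k y ≤ v := hkv ▸ A.le_map k hk _ _ hyv
  have hkyc : P (k y) c := hkc ▸ hP.inv k hk _ _ hyc
  exact hw (hP.down _ _ _ hwc
    (hnest (k y) (hus.trans hsy) (hP.down _ _ _ (hyv'.trans hvz) hxz) c hkyc))

theorem IsCoarsest.mem_class (hE : A.IsCoarsest E) {a : M} {C : Set M} (hdown : IsLowerSet C)
    (hC : C ≠ Set.univ) (hinv : ∀ g ∈ A.G, g a = a → ∀ x, x ∈ C → g x ∈ C) {x : M}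
    (hx : x ∈ C) (hax : a < x) : E a x := by
  by_contra hn
  have : Nonempty M := ⟨a⟩
  refine hE.not_isFarBound (P := fun u v => ∃ g ∈ A.G, g a = u ∧ g.symm v ∈ C) ⟨?_, ?_, ?_, ?_⟩
  · rintro g hg u v ⟨k, hk, rfl, hv⟩
    exact ⟨g * k, A.G.mul_mem hg hk, rfl, by
      change k.symm (g.symm (g v)) ∈ C
      simpa using hv⟩
  · rintro u v w hvw ⟨g, hg, rfl, hw⟩
    exact ⟨g, hg, rfl, hdown (A.le_map g⁻¹ (A.G.inv_mem hg) _ _ hvw) hw⟩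
  · intro u
    obtain ⟨y, hy⟩ := (Set.ne_univ_iff_exists_notMem C).1 hC
    obtain ⟨g, hg, rfl⟩ := A.exists_map_eq a u
    refine ⟨g y, ?_⟩
    rintro ⟨k, hk, hka, hky⟩
    have := hinv (g⁻¹ * k) (A.G.mul_mem (A.G.inv_mem hg) hk) (by simp [hka]) _ hky
    exact hy (by simpa using this)
  · intro u
    obtain ⟨g, hg, rfl⟩ := A.exists_map_eq a u
    exact ⟨g x, lt_map hg hax, fun h => hn ((hE.inv.iff hg a x).1 h), g, hg, rfl, by simpa⟩

end Finite

end OrderLikeAction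

namespace BinStruct

variable {m : ℕ} {M : Type*} (S : BinStruct m M)

/-- The linear order of `S`. -/
@[reducible] noncomputable def linearOrder : LinearOrder M where
  le := S.le
  le_refl x := (S.total x x).elim id id
  le_trans := S.trans
  le_antisymm := S.antisymm
  le_total := S.total
  toDecidableLE := Classical.decRel _

/-- The isomorphism type of a pair. -/
def pairType (x y : M) (i : Fin m) : Prop × Prop × Prop × Prop :=
  (S.rel i x x, S.rel i x y, S.rel i y x, S.rel i y y)

variable {S}

theorem pairType_eq_iff {a b c d : M} : S.pairType a b = S.pairType c d ↔
    ∀ i, (S.rel i a a ↔ S.rel i c c) ∧ (S.rel i a b ↔ S.rel i c d) ∧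
      (S.rel i b a ↔ S.rel i d c) ∧ (S.rel i b b ↔ S.rel i d d) := by
  simp [pairType, funext_iff]

theorem eq_iff_of_pairType_eq {a b c d : M} (h : S.pairType a b = S.pairType c d) :
    a = b ↔ c = d := by
  have key : ∀ x y, x = y ↔ S.rel S.ord x y ∧ S.rel S.ord y x := fun x y =>
    ⟨by rintro rfl; simpa using S.total x x, fun h => S.antisymm _ _ h.1 h.2⟩
  obtain ⟨-, h1, h2, -⟩ := pairType_eq_iff.1 h S.ord
  rw [key, key, h1, h2]

theorem Homogeneous.exists_map_triple (hhom : S.Homogeneous) {a b c a' b' c' : M}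
    (hab : S.pairType a b = S.pairType a' b') (hbc : S.pairType b c = S.pairType b' c')
    (hac : S.pairType a c = S.pairType a' c') :
    ∃ σ : M ≃ M, S.IsAuto σ ∧ σ a = a' ∧ σ b = b' ∧ σ c = c' := by
  classical
  have eab := eq_iff_of_pairType_eq hab
  have ebc := eq_iff_of_pairType_eq hbc
  have eac := eq_iff_of_pairType_eq hac
  let f : M → M := fun x => if x = a then a' else if x = b then b' else c'
  have fa : f a = a' := by simp [f]
  have fb : f b = b' := by
    by_cases h : b = a
    · simp [f, h, eab.1 h.symm]
    · simp [f, h]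
  have fc : f c = c' := by
    by_cases h : c = a
    · simp [f, h, eac.1 h.symm]
    · by_cases h' : c = b
      · rw [h', fb, ebc.1 h'.symm]
      · simp [f, h, h']
  rw [pairType_eq_iff] at hab hbc hac
  obtain ⟨σ, hσ, h⟩ := hhom {a, b, c} f
    (by
      intro x hx y hy hxy
      simp only [Finset.coe_insert, Finset.coe_singleton, Set.mem_insert_iff,
        Set.mem_singleton_iff] at hx hy
      rcases hx with rfl | rfl | rfl <;> rcases hy with rfl | rfl | rfl <;>
        simp only [fa, fb, fc] at hxy <;> first | rfl | grind)
    (by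
      intro i x hx y hy
      simp only [Finset.mem_insert, Finset.mem_singleton] at hx hy
      obtain ⟨h1, h2, h3, h4⟩ := hab i
      obtain ⟨-, h5, h6, h7⟩ := hbc i
      obtain ⟨-, h8, h9, -⟩ := hac i
      rcases hx with rfl | rfl | rfl <;> rcases hy with rfl | rfl | rfl <;>
        simp only [fa, fb, fc] <;> assumption)
  exact ⟨σ, hσ, (h a (by simp)).trans fa, (h b (by simp)).trans fb, (h c (by simp)).trans fc⟩

theorem Homogeneous.exists_map_pair (hhom : S.Homogeneous) {a b c d : M}
    (h : S.pairType a b = S.pairType c d) : S.SamePairOrbit a b c d := by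
  have hb : S.pairType b b = S.pairType d d := by
    rw [pairType_eq_iff] at h ⊢
    exact fun i => ⟨(h i).2.2.2, (h i).2.2.2, (h i).2.2.2, (h i).2.2.2⟩
  obtain ⟨σ, hσ, ha, hb, -⟩ := hhom.exists_map_triple h hb h
  exact ⟨σ, hσ, ha, hb⟩

theorem IsAuto.pairType_map {σ : M ≃ M} (hσ : S.IsAuto σ) (x y : M) :
    S.pairType (σ x) (σ y) = S.pairType x y :=
  pairType_eq_iff.2 fun i => ⟨(hσ i _ _).symm, (hσ i _ _).symm, (hσ i _ _).symm, (hσ i _ _).symm⟩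

/-- The action of the automorphism group of a homogeneous order-like transitive structure. -/
noncomputable def orderLikeAction (hhom : S.Homogeneous) (hol : S.OrderLike)
    (htr : S.TransAction) :
    @OrderLikeAction M (Fin m → Prop × Prop × Prop × Prop) S.linearOrder :=
  letI := S.linearOrder
  { G :=
      { carrier := {σ | S.IsAuto σ}
        mul_mem' := fun {σ ρ} hσ hρ i x y => (hρ i x y).trans (hσ i _ _)
        one_mem' := fun _ _ _ => Iff.rfl
        inv_mem' := fun {σ} hσ i x y => by
          have := hσ i (σ⁻¹ x) (σ⁻¹ y)
          simpa using this.symm }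
    T := S.pairType
    le_map := fun g hg x y h => (hg S.ord x y).1 h
    T_map := fun g hg x y => IsAuto.pairType_map hg x y
    exists_map_eq := htr
    exists_map_pair := fun a b c d h => hhom.exists_map_pair h
    exists_map_triple := fun a b c a' b' c' h1 h2 h3 => hhom.exists_map_triple h1 h2 h3
    orderLike := fun a b c h => by
      obtain ⟨σ, hσ, h1, h2⟩ := hol a b c (hhom.exists_map_pair h)
      have := IsAuto.pairType_map hσ a b
      rwa [h1, h2] at this }

end BinStruct

/-- If `M` is a countably infinite homogeneous, order-like, transitive binary structure with a
distinguished linear order `≤`, `E` is the coarsest proper ∅-definable `≤`-convex equivalence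
relation, and `C` is a cut of `(M,≤)` invariant under all automorphisms fixing `a`, then
`inf(a/E) ≤ C ≤ sup(a/E)`. -/
theorem cut_between_inf_and_sup_of_class
    {m : ℕ} {M : Type*} [Countable M] [Infinite M] (S : BinStruct m M)
    (hhom : S.Homogeneous) (hol : S.OrderLike) (htr : S.TransAction)
    (E : M → M → Prop) (hEdef : S.Definable E) (hEequiv : Equivalence E)
    (hEconv : S.Convex E) (hEproper : ¬ ∀ x y, E x y)
    (hEcoarsest : ∀ F : M → M → Prop, S.Definable F → Equivalence F → S.Convex F →
      (¬ ∀ x y, F x y) → ∀ x y, F x y → E x y)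
    (a : M) (C : Set M) (hC : S.IsCut C)
    (hCinv : ∀ σ : M ≃ M, S.IsAuto σ → σ a = a → ∀ x, x ∈ C ↔ σ x ∈ C) :
    (∀ x, (∀ y, E a y → S.le x y ∧ x ≠ y) → x ∈ C) ∧
    (∀ x ∈ C, ∃ y, E a y ∧ S.le x y) := by
  let := S.linearOrder
  let A := S.orderLikeAction hhom hol htr
  have hE : A.IsCoarsest E :=
    { equiv := hEequiv
      inv := fun g hg x y => (hEdef g hg x y).1
      convex := hEconv
      coarsest := fun F hF => hEcoarsest F fun σ hσ x y => (hF.iff hσ x y).symm }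
  obtain ⟨⟨c, hc⟩, hne, hdown, -⟩ := hC
  constructor
  · intro x hx
    by_contra hxC
    have hxa : x < a := lt_of_le_of_ne (hx a (hEequiv.refl a)).1 (hx a (hEequiv.refl a)).2
    refine (hx x ?_).2 rfl
    exact hE.dual.mem_class (M := Mᵒᵈ) (C := Cᶜ) (fun u v huv hu hv => hu (hdown u v huv hv))
      (fun h => (h ▸ Set.mem_univ c : c ∈ Cᶜ) hc)
      (fun g hg hga u hu hgu => hu ((hCinv g hg hga u).2 hgu)) hxC hxa
  · intro x hx
    by_contra! hcon
    have hax : a < x := lt_of_not_ge (hcon a (hEequiv.refl a))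
    exact hcon x (hE.mem_class (fun u v huv hu => hdown v u huv hu) hne
      (fun g hg hga u => (hCinv g hg hga u).1) hx hax) (le_refl x)
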